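/- arXiv:2311.06514 — 2 statements merged into one kernel-verified Lean document; each statement's English description precedes it below -/
import Mathlib

section
/- The class of data languages accepted by deterministic SAFA is strictly contained in the class of data languages accepted by (nondeterministic) SAFA: L_DSAFA ⊊ L_SAFA. A witness is the language L_∃cnt≠2 over Σ = {a} of data words in which some data value occurs a number of times different from 2: it is accepted by a SAFA but by no DSAFA. -/
/-- A condition tested by a SAFA transition: membership (`pos h` = `p(h)`)
or non-membership (`neg h` = `!p(h)`) of the current data value in set `h`. -/
inductive SafaCond (H : Type) : Type
  | pos (h : H)
  | neg (h : H)

/-- The set name a condition refers to. -/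
def SafaCond.name {H : Type} : SafaCond H → H
  | .pos h => h
  | .neg h => h

/-- An operation of a SAFA transition: do nothing (`−`) or insert the
current data value into set `h` (`ins(h)`). -/
inductive SafaOp (H : Type) : Type
  | noop
  | ins (h : H)

/-- Whether a condition holds for data value `d` given set contents `s`. -/
def SafaCond.holds {H D : Type} : SafaCond H → D → (H → Set D) → Prop
  | .pos h, d, s => d ∈ s h
  | .neg h, d, s => d ∉ s h

/-- The effect of an operation on the set contents, reading data value `d`. -/
def SafaOp.apply {H D : Type} : SafaOp H → D → (H → Set D) → (H → Set D)
  | .noop, _, s => s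
  | .ins h, d, s => fun j => s j ∪ {x | j = h ∧ x = d}

/-- A transition of a SAFA: source state, attribute, condition, operation, target state. -/
structure SafaTrans (Q A H : Type) : Type where
  src : Q
  attr : A
  cond : SafaCond H
  op : SafaOp H
  dst : Q

/-- A set augmented finite automaton over attributes `A` and data values `D`:
a finite set of states `Q` with initial state `q0` and final states `F`,
a finite collection `H` of set names, and a transition relation `δ`. -/
structure SAFA (A D : Type) : Type 1 where
  Q : Type
  fintypeQ : Fintype Q
  q0 : Q
  F : Set Q
  H : Type
  fintypeH : Fintype H
  δ : Set (SafaTrans Q A H)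

attribute [instance] SAFA.fintypeQ SAFA.fintypeH

namespace SAFA

variable {A D : Type}

/-- A configuration: a state together with the current contents of the sets. -/
abbrev Config (M : SAFA A D) : Type := M.Q × (M.H → Set D)

/-- The initial configuration: initial state, all sets empty. -/
def init (M : SAFA A D) : M.Config := (M.q0, fun _ => ∅)

/-- One step: from configuration `c`, taking transition `t` while reading letter `ad`,
reaching configuration `c'`. -/
def StepVia (M : SAFA A D) (c : M.Config) (t : SafaTrans M.Q A M.H)
    (ad : A × D) (c' : M.Config) : Prop :=
  t ∈ M.δ ∧ t.src = c.1 ∧ t.attr = ad.1 ∧ t.dst = c'.1 ∧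
    t.cond.holds ad.2 c.2 ∧ c'.2 = t.op.apply ad.2 c.2

/-- Execution of a sequence of transitions `T` reading the data word `w`,
from configuration `c` to configuration `c'`. -/
inductive ExecFrom (M : SAFA A D) :
    M.Config → List (SafaTrans M.Q A M.H) → List (A × D) → M.Config → Prop
  | nil (c : M.Config) : ExecFrom M c [] [] c
  | cons {c c' c'' : M.Config} {t : SafaTrans M.Q A M.H}
      {ts : List (SafaTrans M.Q A M.H)} {ad : A × D} {w : List (A × D)} :
      M.StepVia c t ad c' → ExecFrom M c' ts w c'' → ExecFrom M c (t :: ts) (ad :: w) c''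

/-- Acceptance: some run from the initial configuration consumes all of `w`
and ends in a final state. -/
def Accepts (M : SAFA A D) (w : List (A × D)) : Prop :=
  ∃ T c, M.ExecFrom M.init T w c ∧ c.1 ∈ M.F

/-- The data language accepted by `M`. -/
def Lang (M : SAFA A D) : Set (List (A × D)) := {w | M.Accepts w}

/-- A SAFA is deterministic if, for every state and attribute, all outgoing
transitions test membership in one and the same set, with at most one transition
per polarity of the condition. -/
def IsDeterministic (M : SAFA A D) : Prop :=
  ∀ t1 t2 : SafaTrans M.Q A M.H, t1 ∈ M.δ → t2 ∈ M.δ →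
    t1.src = t2.src → t1.attr = t2.attr →
    t1.cond.name = t2.cond.name ∧ (t1.cond = t2.cond → t1 = t2)

end SAFA

/-- L_∃cnt≠2 over the one-letter alphabet: some occurring data value occurs a number of
times different from 2. -/
def LExCntNe2 (D : Type) [DecidableEq D] : Set (List (Unit × D)) :=
  {w | ∃ d, d ∈ w.map Prod.snd ∧ (w.map Prod.snd).count d ≠ 2}

namespace SAFA

variable {A D : Type}

/-- Some run reading `w` leads from configuration `c` to configuration `c'`. -/
def Reach (M : SAFA A D) (c : M.Config) (w : List (A × D)) (c' : M.Config) : Prop :=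
  ∃ T, M.ExecFrom c T w c'

/-- Some run from configuration `c` consumes `w` and ends in a final state. -/
def AcceptsFrom (M : SAFA A D) (c : M.Config) (w : List (A × D)) : Prop :=
  ∃ c', M.Reach c w c' ∧ c'.1 ∈ M.F

theorem accepts_iff_acceptsFrom_init {M : SAFA A D} {w : List (A × D)} :
    M.Accepts w ↔ M.AcceptsFrom M.init w :=
  ⟨fun ⟨T, c, h, hF⟩ => ⟨c, ⟨T, h⟩, hF⟩, fun ⟨c, ⟨T, h⟩, hF⟩ => ⟨T, c, h, hF⟩⟩

theorem reach_nil {M : SAFA A D} {c c' : M.Config} : M.Reach c [] c' ↔ c' = c := by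
  constructor
  · rintro ⟨T, h⟩
    cases h
    rfl
  · rintro rfl
    exact ⟨[], .nil _⟩

theorem reach_cons {M : SAFA A D} {c c'' : M.Config} {ad : A × D} {w : List (A × D)} :
    M.Reach c (ad :: w) c'' ↔ ∃ t c', M.StepVia c t ad c' ∧ M.Reach c' w c'' := by
  constructor
  · rintro ⟨T, h⟩
    cases h with
    | cons hs h => exact ⟨_, _, hs, _, h⟩
  · rintro ⟨t, c', hs, T, h⟩
    exact ⟨_, .cons hs h⟩

theorem reach_append {M : SAFA A D} {c c'' : M.Config} {u v : List (A × D)} :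
    M.Reach c (u ++ v) c'' ↔ ∃ c', M.Reach c u c' ∧ M.Reach c' v c'' := by
  induction u generalizing c with
  | nil => simp [reach_nil]
  | cons a u ih =>
    simp only [List.cons_append, reach_cons, ih]
    constructor
    · rintro ⟨t, c₁, hs, c₂, h₁, h₂⟩
      exact ⟨c₂, ⟨t, c₁, hs, h₁⟩, h₂⟩
    · rintro ⟨c₂, ⟨t, c₁, hs, h₁⟩, h₂⟩
      exact ⟨t, c₁, hs, c₂, h₁, h₂⟩

theorem acceptsFrom_nil {M : SAFA A D} {c : M.Config} : M.AcceptsFrom c [] ↔ c.1 ∈ M.F := by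
  simp [AcceptsFrom, reach_nil]

theorem acceptsFrom_cons {M : SAFA A D} {c : M.Config} {ad : A × D} {w : List (A × D)} :
    M.AcceptsFrom c (ad :: w) ↔ ∃ t ∈ M.δ, t.src = c.1 ∧ t.attr = ad.1 ∧
      t.cond.holds ad.2 c.2 ∧ M.AcceptsFrom (t.dst, t.op.apply ad.2 c.2) w := by
  simp only [AcceptsFrom, reach_cons]
  constructor
  · rintro ⟨c'', ⟨t, ⟨q, s⟩, ⟨hδ, hsrc, hattr, hdst, hc, hs⟩, hr⟩, hF⟩
    simp only at hdst hs
    subst hdst hs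
    exact ⟨t, hδ, hsrc, hattr, hc, c'', hr, hF⟩
  · rintro ⟨t, hδ, hsrc, hattr, hc, c'', hr, hF⟩
    exact ⟨c'', ⟨t, _, ⟨hδ, hsrc, hattr, rfl, hc, rfl⟩, hr⟩, hF⟩

theorem acceptsFrom_append {M : SAFA A D} {c : M.Config} {u v : List (A × D)} :
    M.AcceptsFrom c (u ++ v) ↔ ∃ c', M.Reach c u c' ∧ M.AcceptsFrom c' v := by
  simp only [AcceptsFrom, reach_append]
  constructor
  · rintro ⟨c₂, ⟨c₁, h₁, h₂⟩, hF⟩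
    exact ⟨c₁, h₁, c₂, h₂, hF⟩
  · rintro ⟨c₁, h₁, c₂, h₂, hF⟩
    exact ⟨c₂, ⟨c₁, h₁, h₂⟩, hF⟩

/-- In a deterministic SAFA the configuration reached on a word is unique. -/
theorem IsDeterministic.reach_unique {M : SAFA A D} (hM : M.IsDeterministic)
    {c c₁ c₂ : M.Config} {w : List (A × D)} (h₁ : M.Reach c w c₁) (h₂ : M.Reach c w c₂) :
    c₁ = c₂ := by
  induction w generalizing c with
  | nil => rw [reach_nil.1 h₁, reach_nil.1 h₂]
  | cons a w ih =>
    obtain ⟨t₁, e₁, ⟨hδ₁, hs₁, ha₁, hd₁, hc₁, he₁⟩, hr₁⟩ := reach_cons.1 h₁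
    obtain ⟨t₂, e₂, ⟨hδ₂, hs₂, ha₂, hd₂, hc₂, he₂⟩, hr₂⟩ := reach_cons.1 h₂
    obtain ⟨hname, heq⟩ := hM t₁ t₂ hδ₁ hδ₂ (hs₁.trans hs₂.symm) (ha₁.trans ha₂.symm)
    have hcond : t₁.cond = t₂.cond := by
      revert hname hc₁ hc₂
      cases t₁.cond <;> cases t₂.cond <;> simp only [SafaCond.name, SafaCond.holds] <;>
        intro hc₁ hc₂ hname <;> subst hname <;> first | rfl | contradiction
    obtain rfl := heq hcond
    have : e₁ = e₂ := Prod.ext (hd₁.symm.trans hd₂) (he₁.trans he₂.symm)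
    subst this
    exact ih hr₁ hr₂

theorem mem_apply_of_ne {H D : Type} (op : SafaOp H) {d x : D} (hx : x ≠ d) (s : H → Set D)
    (h : H) : x ∈ op.apply d s h ↔ x ∈ s h := by
  cases op <;> simp [SafaOp.apply, hx]

theorem mem_apply_congr {H D : Type} (op : SafaOp H) {d x : D} {s s' : H → Set D} {h : H}
    (hx : x ∈ s h ↔ x ∈ s' h) : x ∈ op.apply d s h ↔ x ∈ op.apply d s' h := by
  cases op <;> simp [SafaOp.apply, hx]

theorem holds_congr {H D : Type} (cond : SafaCond H) {d : D} {s s' : H → Set D}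
    (hd : ∀ h, d ∈ s h ↔ d ∈ s' h) : cond.holds d s ↔ cond.holds d s' := by
  cases cond <;> simp [SafaCond.holds, hd]

/-- A run only changes the membership of the data values it reads. -/
theorem Reach.mem_iff_of_notMem {M : SAFA A D} {c c' : M.Config} {w : List (A × D)}
    (hr : M.Reach c w c') {x : D} (hx : x ∉ w.map Prod.snd) (h : M.H) :
    x ∈ c'.2 h ↔ x ∈ c.2 h := by
  induction w generalizing c with
  | nil => rw [reach_nil.1 hr]
  | cons a w ih =>
    obtain ⟨t, e, ⟨-, -, -, -, -, he⟩, hr⟩ := reach_cons.1 hr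
    simp only [List.map_cons, List.mem_cons, not_or] at hx
    rw [ih hr hx.2, he, mem_apply_of_ne _ hx.1]

/-- Acceptance of `w` depends only on the state and the membership of the values in `w`. -/
theorem AcceptsFrom.congr {M : SAFA A D} {c e : M.Config} {w : List (A × D)}
    (ha : M.AcceptsFrom c w) (hq : c.1 = e.1)
    (hs : ∀ x ∈ w.map Prod.snd, ∀ h, x ∈ c.2 h ↔ x ∈ e.2 h) : M.AcceptsFrom e w := by
  induction w generalizing c e with
  | nil => simpa [acceptsFrom_nil, ← hq] using ha
  | cons a w ih =>
    obtain ⟨t, hδ, hsrc, hattr, hc, ha⟩ := acceptsFrom_cons.1 ha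
    refine acceptsFrom_cons.2 ⟨t, hδ, hsrc.trans hq, hattr,
      (holds_congr _ (hs a.2 (by simp))).1 hc, ih ha rfl fun x hx h => ?_⟩
    exact mem_apply_congr _ (hs x (by rw [List.map_cons]; exact List.mem_cons_of_mem _ hx) h)

end SAFA

/-- Transitions of `cntNe2Safa`: state `0` collects the values read so far in the set `false`
until a new value is guessed and stored in the set `true`; state `k ≥ 1` means that the guessed
value has been read `k` times (at least `3` times if `k = 3`). -/
inductive CntNe2Trans : SafaTrans (Fin 4) Unit Bool → Prop
  | skip : CntNe2Trans ⟨0, (), .neg true, .ins false, 0⟩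
  | guess : CntNe2Trans ⟨0, (), .neg false, .ins true, 1⟩
  | other (q : Fin 4) (hq : q ≠ 0) : CntNe2Trans ⟨q, (), .neg true, .noop, q⟩
  | hit₁ : CntNe2Trans ⟨1, (), .pos true, .noop, 2⟩
  | hit₂ : CntNe2Trans ⟨2, (), .pos true, .noop, 3⟩
  | hit₃ : CntNe2Trans ⟨3, (), .pos true, .noop, 3⟩

/-- A SAFA guessing a data value and checking that it does not occur exactly twice. -/
def cntNe2Safa (D : Type) : SAFA Unit D where
  Q := Fin 4
  fintypeQ := inferInstance
  q0 := 0
  F := {q | q = 1 ∨ q = 3}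
  H := Bool
  fintypeH := inferInstance
  δ := {t | CntNe2Trans t}

section

variable {D : Type} [DecidableEq D]

theorem cntNe2Safa_acceptsFrom_of_ne_zero {q : Fin 4} (hq : q ≠ 0) {d : D}
    {s : Bool → Set D} (hs : s true = {d}) (w : List (Unit × D)) :
    (cntNe2Safa D).AcceptsFrom (q, s) w ↔ q.val + (w.map Prod.snd).count d ≠ 2 := by
  have h₂ : (2 : Fin 4) ≠ 0 := by decide
  have h₃ : (3 : Fin 4) ≠ 0 := by decide
  induction w generalizing q with
  | nil =>
    rw [SAFA.acceptsFrom_nil]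
    change (q = 1 ∨ q = 3) ↔ _
    revert hq
    revert q
    simp only [List.map_nil, List.count_nil]
    decide
  | cons a w ih =>
    obtain ⟨⟨⟩, x⟩ := a
    rw [SAFA.acceptsFrom_cons]
    constructor
    · rintro ⟨t, ht, hsrc, -, hc, ha⟩
      change CntNe2Trans t at ht
      cases ht
      case skip => exact absurd hsrc.symm hq
      case guess => exact absurd hsrc.symm hq
      case other q' hq' =>
        have hne : x ≠ d := by simpa [SafaCond.holds, hs] using hc
        obtain rfl : q' = q := hsrc
        have := (ih hq).1 ha
        simpa [List.count_cons, hne] using this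
      all_goals
        have heq : x = d := by simpa [SafaCond.holds, hs] using hc
        have := (ih (by first | exact h₂ | exact h₃)).1 ha
        obtain rfl := hsrc
        simp [heq] at this ⊢
        try omega
    · intro h
      by_cases hx : x = d
      · subst hx
        have hmem : x ∈ s true := by simp [hs]
        have hcases : q = 1 ∨ q = 2 ∨ q = 3 := by
          clear h; revert hq; revert q; decide
        simp only [List.map_cons, List.count_cons_self] at h
        rcases hcases with rfl | rfl | rfl
        · refine ⟨_, CntNe2Trans.hit₁, rfl, rfl, hmem, (ih h₂).2 ?_⟩
          simp at h ⊢
          omega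
        · exact ⟨_, CntNe2Trans.hit₂, rfl, rfl, hmem, (ih h₃).2 (by simp; omega)⟩
        · exact ⟨_, CntNe2Trans.hit₃, rfl, rfl, hmem, (ih h₃).2 (by simp; omega)⟩
      · refine ⟨_, CntNe2Trans.other q hq, rfl, rfl, ?_, (ih hq).2 ?_⟩
        · simpa [SafaCond.holds, hs] using hx
        · simpa [List.count_cons, hx] using h

theorem cntNe2Safa_acceptsFrom_zero {s : Bool → Set D} (hs : s true = ∅)
    (w : List (Unit × D)) :
    (cntNe2Safa D).AcceptsFrom ((0 : Fin 4), s) w ↔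
      ∃ d ∈ w.map Prod.snd, d ∉ s false ∧ (w.map Prod.snd).count d ≠ 2 := by
  have h₁ : (1 : Fin 4) ≠ 0 := by decide
  induction w generalizing s with
  | nil =>
    rw [SAFA.acceptsFrom_nil]
    change ((0 : Fin 4) = 1 ∨ (0 : Fin 4) = 3) ↔ _
    simp
  | cons a w ih =>
    obtain ⟨⟨⟩, x⟩ := a
    have hskip : SafaOp.apply (.ins false) x s true = ∅ := by
      simp [SafaOp.apply, hs]
    have hguess : SafaOp.apply (.ins true) x s true = {x} := by
      simp [SafaOp.apply, hs]
    rw [SAFA.acceptsFrom_cons]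
    constructor
    · rintro ⟨t, ht, hsrc, -, hc, ha⟩
      change CntNe2Trans t at ht
      cases ht
      case skip =>
        obtain ⟨d, hd, hds, hcount⟩ := (ih hskip).1 ha
        simp only [SafaOp.apply, Set.mem_union, Set.mem_ofPred_eq, true_and, not_or] at hds
        refine ⟨d, by simp only [List.map_cons, List.mem_cons]; exact .inr hd, hds.1, ?_⟩
        simpa [List.count_cons, Ne.symm hds.2] using hcount
      case guess =>
        have := (cntNe2Safa_acceptsFrom_of_ne_zero h₁ hguess w).1 ha
        refine ⟨x, by simp, hc, ?_⟩
        simp at this ⊢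
        omega
      case other q hq => exact absurd hsrc hq
      case hit₁ => exact absurd hsrc (by change ¬ (1 : Fin 4) = 0; decide)
      case hit₂ => exact absurd hsrc (by change ¬ (2 : Fin 4) = 0; decide)
      case hit₃ => exact absurd hsrc (by change ¬ (3 : Fin 4) = 0; decide)
    · rintro ⟨d, hd, hds, hcount⟩
      by_cases hx : x = d
      · subst hx
        refine ⟨_, CntNe2Trans.guess, rfl, rfl, hds,
          (cntNe2Safa_acceptsFrom_of_ne_zero h₁ hguess w).2 ?_⟩
        simp at hcount ⊢
        omega
      · refine ⟨_, CntNe2Trans.skip, rfl, rfl, by simp [SafaCond.holds, hs],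
          (ih hskip).2 ⟨d, ?_, ?_, ?_⟩⟩
        · simp only [List.map_cons, List.mem_cons] at hd
          exact hd.resolve_left (Ne.symm hx)
        · simpa [SafaOp.apply, Ne.symm hx] using hds
        · simpa [List.count_cons, hx] using hcount

theorem cntNe2Safa_lang : (cntNe2Safa D).Lang = LExCntNe2 D := by
  ext w
  change (cntNe2Safa D).Accepts w ↔ _
  rw [SAFA.accepts_iff_acceptsFrom_init]
  refine (cntNe2Safa_acceptsFrom_zero (s := fun _ => ∅) rfl w).trans ?_
  simp [LExCntNe2]

end

/-- The data word `e 0, …, e (n - 1)` over a one-letter alphabet. -/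
def initialWord {D : Type} (e : ℕ → D) (n : ℕ) : List (Unit × D) :=
  (List.range n).map fun i => ((), e i)

theorem map_snd_initialWord {D : Type} (e : ℕ → D) (n : ℕ) :
    (initialWord e n).map Prod.snd = (List.range n).map e := by
  simp [initialWord, Function.comp_def]

theorem count_initialWord {D : Type} [DecidableEq D] (e : ℕ ↪ D) (n i : ℕ) :
    ((initialWord e n).map Prod.snd).count (e i) = if i < n then 1 else 0 := by
  rw [map_snd_initialWord, List.count_map_of_injective _ _ e.injective,
    List.nodup_range.count]
  simp

/-- Reading `e 0, …, e (m - 1)` and then `e 0, …, e (n - 1)`, with `n ≤ m`, gives a word in which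
every value occurs twice exactly when `n = m`. -/
theorem initialWord_append_mem_iff {D : Type} [DecidableEq D] (e : ℕ ↪ D) {n m : ℕ}
    (hnm : n ≤ m) : initialWord e m ++ initialWord e n ∈ LExCntNe2 D ↔ n < m := by
  simp only [LExCntNe2, Set.mem_ofPred_eq, List.map_append, List.count_append, List.mem_append]
  constructor
  · rintro ⟨d, hd, hcount⟩
    obtain ⟨i, rfl⟩ : ∃ i, e i = d := by
      simp only [map_snd_initialWord, List.mem_map] at hd
      rcases hd with ⟨i, -, h⟩ | ⟨i, -, h⟩ <;> exact ⟨i, h⟩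
    simp only [← List.count_pos_iff, count_initialWord] at hd hcount
    split_ifs at hd hcount <;> omega
  · intro h
    refine ⟨e n, ?_, ?_⟩
    · simp only [← List.count_pos_iff, count_initialWord]
      simp [h]
    · simp [count_initialWord, h]

theorem not_exists_isDeterministic_lang_eq_LExCntNe2 {D : Type} [Infinite D] [DecidableEq D] :
    ¬ ∃ M : SAFA Unit D, M.IsDeterministic ∧ M.Lang = LExCntNe2 D := by
  rintro ⟨M, hM, hL⟩
  let e := Infinite.natEmbedding D
  have hacc : ∀ n m, n ≤ m →
      (M.AcceptsFrom M.init (initialWord e m ++ initialWord e n) ↔ n < m) := by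
    intro n m hnm
    rw [← initialWord_append_mem_iff e hnm, ← hL]
    exact SAFA.accepts_iff_acceptsFrom_init.symm
  have hreach : ∀ m, ∃ c, M.Reach M.init (initialWord e m) c := by
    intro m
    obtain ⟨c, hc, -⟩ := SAFA.acceptsFrom_append.1 ((hacc 0 (m + 1) (by omega)).2 (by omega))
    have hsplit : initialWord e (m + 1) = initialWord e m ++ [((), e m)] := by
      simp [initialWord, List.range_succ]
    rw [hsplit] at hc
    obtain ⟨c', hc', -⟩ := SAFA.reach_append.1 hc
    exact ⟨c', hc'⟩
  choose c hc using hreach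
  obtain ⟨n, m, hnm, hq⟩ : ∃ n m, n < m ∧ (c n).1 = (c m).1 := by
    obtain ⟨n, m, hne, hq⟩ := Finite.exists_ne_map_eq_of_infinite fun n => (c n).1
    rcases lt_or_gt_of_ne hne with h | h
    · exact ⟨n, m, h, hq⟩
    · exact ⟨m, n, h, hq.symm⟩
  obtain ⟨k, rfl⟩ := Nat.exists_eq_add_of_lt hnm
  set m := n + k + 1
  obtain ⟨v, hv, hdisj⟩ : ∃ v, initialWord e m = initialWord e n ++ v ∧
      ∀ x ∈ (initialWord e n).map Prod.snd, x ∉ v.map Prod.snd := by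
    refine ⟨(List.range (k + 1)).map fun i => ((), e (n + i)), ?_, ?_⟩
    · simp [initialWord, m, add_assoc, List.range_add, Function.comp_def]
    · rw [map_snd_initialWord]
      simp only [List.map_map, List.mem_map, List.mem_range, Function.comp_apply, not_exists,
        not_and]
      rintro x ⟨i, hi, rfl⟩ j - hj
      have := e.injective hj
      omega
  have hcv : M.Reach (c n) v (c m) := by
    have h := hc m
    rw [hv] at h
    obtain ⟨c', h₁, h₂⟩ := SAFA.reach_append.1 h
    rwa [hM.reach_unique (hc n) h₁]
  obtain ⟨c', h₁, h₂⟩ := SAFA.acceptsFrom_append.1 ((hacc n m hnm.le).2 hnm)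
  rw [hM.reach_unique h₁ (hc m)] at h₂
  have h₃ := h₂.congr hq.symm fun x hx h => hcv.mem_iff_of_notMem (hdisj x hx) h
  exact lt_irrefl n ((hacc n n le_rfl).1 (SAFA.acceptsFrom_append.2 ⟨c n, hc n, h₃⟩))

/-- L_DSAFA ⊊ L_SAFA: every DSAFA language is a SAFA language, and the
language L_∃cnt≠2 is accepted by a SAFA but by no DSAFA. -/
theorem dsafa_strictly_weaker {D : Type} [Countable D] [Infinite D] [DecidableEq D] :
    (∀ (A : Type) (L : Set (List (A × D))),
        (∃ M : SAFA A D, M.IsDeterministic ∧ M.Lang = L) →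
        ∃ M : SAFA A D, M.Lang = L) ∧
    (∃ M : SAFA Unit D, M.Lang = LExCntNe2 D) ∧
    ¬ ∃ M : SAFA Unit D, M.IsDeterministic ∧ M.Lang = LExCntNe2 D := by
  refine ⟨fun A L ⟨M, _, hL⟩ => ⟨M, hL⟩, ⟨cntNe2Safa D, cntNe2Safa_lang⟩,
    not_exists_isDeterministic_lang_eq_LExCntNe2⟩
end

section
/- For any fixed data value d ∈ D and any finite alphabet Σ, no SAFA accepts the data language L_d of all data words that contain at least one position carrying the data value d. (Combined with the fact that L_fd(a) is SAFA-recognizable but not recognizable by any k-register automaton, this yields that the classes of languages of SAFA and of k-register automata are incomparable.) -/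
namespace SAFA

variable {A D : Type}

/-- Renaming of the data values stored in a configuration. -/
def Config.map {M : SAFA A D} (f : D ≃ D) (c : M.Config) : M.Config :=
  (c.1, fun h => f.symm ⁻¹' c.2 h)

theorem StepVia.map {M : SAFA A D} (f : D ≃ D) {c c' : M.Config} {t : SafaTrans M.Q A M.H}
    {ad : A × D} (h : M.StepVia c t ad c') :
    M.StepVia (Config.map f c) t (ad.1, f ad.2) (Config.map f c') := by
  obtain ⟨h_mem, h_src, h_attr, h_dst, h_cond, h_op⟩ := h
  refine ⟨h_mem, h_src, h_attr, h_dst, ?_, ?_⟩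
  · cases h : t.cond <;> simp_all [SafaCond.holds, Config.map]
  · funext j
    ext x
    cases h : t.op <;> simp_all [SafaOp.apply, Config.map, Equiv.symm_apply_eq]

theorem ExecFrom.map {M : SAFA A D} (f : D ≃ D) {c c' : M.Config}
    {T : List (SafaTrans M.Q A M.H)} {w : List (A × D)} (h : M.ExecFrom c T w c') :
    M.ExecFrom (Config.map f c) T (w.map (Prod.map id f)) (Config.map f c') := by
  induction h with
  | nil c => exact .nil _
  | cons h_step _ ih => exact .cons (h_step.map f) ih

/-- Acceptance by a SAFA is invariant under permutations of the data values. -/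
theorem Accepts.map {M : SAFA A D} (f : D ≃ D) {w : List (A × D)} (h : M.Accepts w) :
    M.Accepts (w.map (Prod.map id f)) := by
  obtain ⟨T, c, h_exec, h_final⟩ := h
  exact ⟨T, Config.map f c, h_exec.map f, h_final⟩

end SAFA

/-- for a fixed data value d and any (nonempty) finite alphabet, no SAFA
accepts the language L_d of data words containing the data value d at some position. -/
theorem safa_cannot_accept_Ld {A D : Type} [Fintype A] [Nonempty A]
    [Countable D] [Infinite D] (d : D) :
    ¬ ∃ M : SAFA A D, M.Lang = {w : List (A × D) | ∃ p ∈ w, p.2 = d} := by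
  rintro ⟨M, hM⟩
  obtain ⟨a⟩ := ‹Nonempty A›
  obtain ⟨e, he⟩ := exists_ne d
  classical
  have h_acc : [(a, d)] ∈ M.Lang := by simp [hM]
  have h_swap : [(a, d)].map (Prod.map id (Equiv.swap d e)) ∈ M.Lang :=
    SAFA.Accepts.map (Equiv.swap d e) h_acc
  rw [hM] at h_swap
  simp [he.symm] at h_swap
end
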